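/- arXiv:1403.3064 — 2 statements merged into one kernel-verified Lean document; each statement's English description precedes it below -/
import Mathlib

section
/- Let F be a field of characteristic 2, let φ and ψ be nonsingular quadratic forms over F and let σ ≅ ⟨c_1,...,c_n⟩ be a totally singular quadratic form over F. Then the following are equivalent: (a) φ ⊥ σ is dominated by ψ; (b) there exist a nonsingular quadratic form τ over F of dimension dim ψ − dim φ − 2·dim σ and elements d_1,...,d_n ∈ F with ψ ≅ φ ⊥ [c_1,d_1] ⊥ ... ⊥ [c_n,d_n] ⊥ τ; (c) there exists a nonsingular quadratic form τ over F of dimension dim ψ − dim φ − 2n such that ψ ⊥ φ ⊥ σ is Witt equivalent to τ ⊥ σ. -/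
open QuadraticMap

variable (F : Type) [Field F]

/-- Quadratic forms on `Fin n → F`. -/
abbrev QF (n : ℕ) := QuadraticForm F (Fin n → F)

/-- The nonsingular binary quadratic form `[a,b] = a x² + x y + b y²`. -/
noncomputable def binQF (a b : F) : QF F 2 :=
  (Matrix.of ![![a, 1], ![0, b]]).toQuadraticMap'

/-- The totally singular diagonal quadratic form `⟨c₁, …, c_n⟩ = Σ cᵢ xᵢ²`. -/
noncomputable def diagQF {n : ℕ} (c : Fin n → F) : QF F n :=
  QuadraticMap.weightedSumSquares F c

/-- Orthogonal sum of a finite family of quadratic forms of the same dimension. -/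
noncomputable def oSumFam {k n : ℕ} (q : Fin k → QF F n) : QF F (k * n) :=
  (QuadraticMap.pi q).comp
    ((LinearEquiv.curry F F (Fin k) (Fin n)).toLinearMap.comp
      (LinearEquiv.funCongrLeft F F finProdFinEquiv).toLinearMap)

/-- Orthogonal sum of two quadratic forms. -/
noncomputable def oSum {n m : ℕ} (q₁ : QF F n) (q₂ : QF F m) : QF F (n + m) :=
  (QuadraticMap.prod q₁ q₂).comp
    ((LinearEquiv.sumArrowLequivProdArrow (Fin n) (Fin m) F F).toLinearMap.comp
      (LinearEquiv.funCongrLeft F F finSumFinEquiv).toLinearMap)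

section General
variable {M N : Type} [AddCommGroup M] [Module F M] [AddCommGroup N] [Module F N]

/-- Two quadratic forms are isometric if there is an isometry (isomorphism preserving the
form) between them. -/
def QIsometric (q₁ : QuadraticForm F M) (q₂ : QuadraticForm F N) : Prop :=
  Nonempty (QuadraticMap.IsometryEquiv q₁ q₂)

/-- `q₁` is dominated by `q₂` (written `q₁ ≺ q₂`) if there is an injective linear map `t`
with `q₁ x = q₂ (t x)` for all `x`. -/
def Dominates (q₁ : QuadraticForm F M) (q₂ : QuadraticForm F N) : Prop :=
  ∃ t : M →ₗ[F] N, Function.Injective t ∧ ∀ x, q₁ x = q₂ (t x)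

/-- A quadratic form is nonsingular if the radical of its polar form is trivial. -/
def Nonsingular (q : QuadraticForm F M) : Prop :=
  ∀ x, (∀ y, polar q x y = 0) → x = 0

/-- A quadratic form is totally singular if its polar form vanishes identically. -/
def TotallySingular (q : QuadraticForm F M) : Prop :=
  ∀ x y, polar q x y = 0

/-- A quadratic form is hyperbolic if it is isometric to an orthogonal sum of
hyperbolic planes `ℍ = [0,0]`. -/
def Hyperbolic (q : QuadraticForm F M) : Prop :=
  ∃ k : ℕ, QIsometric F q (oSumFam F fun _ : Fin k => binQF F 0 0)

/-- Witt equivalence: two quadratic forms are Witt equivalent iff they have isometric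
anisotropic parts, i.e. both are isometric to `i × ℍ ⊥ ρ ⊥ j × ⟨0⟩` for a common
anisotropic form `ρ`. -/
def WittEquiv (q₁ : QuadraticForm F M) (q₂ : QuadraticForm F N) : Prop :=
  ∃ (r : ℕ) (ρ : QF F r), ρ.Anisotropic ∧
    (∃ i j : ℕ, QIsometric F q₁
      (oSum F (oSum F (oSumFam F fun _ : Fin i => binQF F 0 0) ρ) (diagQF F (0 : Fin j → F)))) ∧
    (∃ i j : ℕ, QIsometric F q₂
      (oSum F (oSum F (oSumFam F fun _ : Fin i => binQF F 0 0) ρ) (diagQF F (0 : Fin j → F))))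

end General

/-- The Gram-type matrix of a quadratic form on `Fin n → F`: diagonal entries are the values
on basis vectors, above-diagonal entries the polar values. -/
noncomputable def qMat {n : ℕ} (q : QF F n) : Matrix (Fin n) (Fin n) F :=
  Matrix.of fun i j =>
    if i = j then q (Pi.single i 1)
    else if i < j then polar q (Pi.single i 1) (Pi.single j 1) else 0

/-- Scalar extension of a quadratic form along `F → E`. -/
noncomputable def extQF (E : Type) [CommRing E] [Algebra F E] {n : ℕ} (q : QF F n) :
    QuadraticForm E (Fin n → E) :=
  ((qMat F q).map (algebraMap F E)).toQuadraticMap'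

/-- Membership of the Witt class of `q` in the kernel `W_q(E/F)` of `W_qF → W_qE`:
the scalar extension of `q` is Witt equivalent to the zero form. -/
def InWqKernel (E : Type) [Field E] [Algebra F E] {n : ℕ} (q : QF F n) : Prop :=
  WittEquiv E (extQF F E q) (0 : QF E 0)

/-- The 2-fold quadratic Pfister form `⟨⟨g,h]] = ⟨1,g⟩_b ⊗ [1,h] = [1,h] ⊥ g[1,h]`. -/
noncomputable def pf2 (g h : F) : QF F 4 :=
  oSum F (binQF F 1 h) (g • binQF F 1 h)

/-- The 3-fold quadratic Pfister form `⟨⟨g₁,g₂,h]] = ⟨1,g₁⟩_b ⊗ ⟨1,g₂⟩_b ⊗ [1,h]`. -/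
noncomputable def pf3 (g₁ g₂ h : F) : QF F 8 :=
  oSum F (pf2 F g₂ h) (g₁ • pf2 F g₂ h)

/-- Orthogonal sum of a list of quadratic forms of varying dimensions. -/
noncomputable def listOSum : List (Σ n, QF F n) → Σ n, QF F n
  | [] => ⟨0, 0⟩
  | x :: L => ⟨x.1 + (listOSum L).1, oSum F x.2 (listOSum L).2⟩

/-- The cubic resolvent `f_C(X) = X³ + bX² + acX + (a²d + c²)` of
`f(X) = X⁴ + aX³ + bX² + cX + d`, evaluated at `e`. -/
def cubicResolvent (a b c d e : F) : F := e ^ 3 + b * e ^ 2 + a * c * e + (a ^ 2 * d + c ^ 2)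

section Auxiliary
variable {F}
variable {M N P : Type} [AddCommGroup M] [Module F M] [AddCommGroup N] [Module F N]
  [AddCommGroup P] [Module F P]

/-- The binary form `a x² + x y + b y²` on `F × F`. -/
noncomputable def binForm (a b : F) : QuadraticForm F (F × F) :=
  a • linMulLin (LinearMap.fst F F F) (LinearMap.fst F F F) +
    linMulLin (LinearMap.fst F F F) (LinearMap.snd F F F) +
    b • linMulLin (LinearMap.snd F F F) (LinearMap.snd F F F)

/-- The orthogonal sum of the binary forms `[cᵢ, dᵢ]`. -/
noncomputable def binSum {n : ℕ} (c d : Fin n → F) : QuadraticForm F (Fin n → F × F) :=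
  QuadraticMap.pi fun i => binForm (c i) (d i)

/-- The orthogonal sum of `n` hyperbolic planes. -/
noncomputable abbrev hypSum (F : Type) [Field F] (n : ℕ) : QuadraticForm F (Fin n → F × F) :=
  binSum (0 : Fin n → F) 0

theorem binSum_apply {n : ℕ} (c d : Fin n → F) (x : Fin n → F × F) :
    binSum c d x = ∑ i, (c i * ((x i).1 * (x i).1) + (x i).1 * (x i).2
      + d i * ((x i).2 * (x i).2)) := by
  simp [binSum, binForm, QuadraticMap.pi_apply]

theorem hypSum_apply {n : ℕ} (x : Fin n → F × F) :
    hypSum F n x = ∑ i, (x i).1 * (x i).2 := by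
  simp [binSum_apply]

theorem diagQF_apply {n : ℕ} (c : Fin n → F) (x : Fin n → F) :
    diagQF F c x = ∑ i, c i * (x i * x i) := by
  simp [diagQF, weightedSumSquares_apply]

theorem oSum_equivalent_prod {n m : ℕ} (q₁ : QF F n) (q₂ : QF F m) :
    (oSum F q₁ q₂).Equivalent (q₁.prod q₂) :=
  ⟨(isometryEquivOfCompLinearEquiv (q₁.prod q₂)
    ((LinearEquiv.funCongrLeft F F finSumFinEquiv).trans
      (LinearEquiv.sumArrowLequivProdArrow (Fin n) (Fin m) F F))).symm⟩

theorem binQF_apply (a b : F) (x : Fin 2 → F) :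
    binQF F a b x = a * (x 0 * x 0) + x 0 * x 1 + b * (x 1 * x 1) := by
  have h : binQF F a b x = Matrix.toLinearMap₂' F (Matrix.of ![![a, 1], ![0, b]]) x x := rfl
  rw [h, Matrix.toLinearMap₂'_apply']
  simp [Matrix.mulVec, dotProduct, Fin.sum_univ_two]
  ring

theorem oSumFam_equivalent_pi {k n : ℕ} (q : Fin k → QF F n) :
    (oSumFam F q).Equivalent (QuadraticMap.pi q) :=
  ⟨(isometryEquivOfCompLinearEquiv (QuadraticMap.pi q)
    ((LinearEquiv.funCongrLeft F F finProdFinEquiv).trans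
      (LinearEquiv.curry F F (Fin k) (Fin n)))).symm⟩

theorem oSumFam_binQF_equivalent {n : ℕ} (c d : Fin n → F) :
    (oSumFam F fun i => binQF F (c i) (d i)).Equivalent (binSum c d) := by
  refine (oSumFam_equivalent_pi _).trans (Equivalent.pi fun i => ⟨?_⟩)
  refine { LinearEquiv.finTwoArrow F F with map_app' := fun x => ?_ }
  simp [binForm, binQF_apply]

theorem oSumFam_hyp_equivalent (n : ℕ) :
    (oSumFam F fun _ : Fin n => binQF F 0 0).Equivalent (hypSum F n) :=
  oSumFam_binQF_equivalent (0 : Fin n → F) 0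

theorem prodAssoc_equivalent (q₁ : QuadraticForm F M) (q₂ : QuadraticForm F N)
    (q₃ : QuadraticForm F P) :
    ((q₁.prod q₂).prod q₃).Equivalent (q₁.prod (q₂.prod q₃)) :=
  ⟨{ LinearEquiv.prodAssoc F M N P with map_app' := fun x => by simp [add_assoc] }⟩

theorem prodComm_equivalent (q₁ : QuadraticForm F M) (q₂ : QuadraticForm F N) :
    (q₁.prod q₂).Equivalent (q₂.prod q₁) :=
  ⟨IsometryEquiv.prodComm q₁ q₂⟩

theorem prodLeftComm_equivalent (q₁ : QuadraticForm F M) (q₂ : QuadraticForm F N)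
    (q₃ : QuadraticForm F P) :
    (q₁.prod (q₂.prod q₃)).Equivalent (q₂.prod (q₁.prod q₃)) :=
  (prodAssoc_equivalent q₁ q₂ q₃).symm.trans
    (((prodComm_equivalent q₁ q₂).prod (.refl q₃)).trans (prodAssoc_equivalent q₂ q₁ q₃))

theorem equivalent_of_injective [FiniteDimensional F M] [FiniteDimensional F N]
    {q₁ : QuadraticForm F M} {q₂ : QuadraticForm F N} (f : M →ₗ[F] N)
    (hf : Function.Injective f) (h : Module.finrank F M = Module.finrank F N)
    (hq : ∀ x, q₂ (f x) = q₁ x) : q₁.Equivalent q₂ :=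
  ⟨{ f.linearEquivOfInjective hf h with map_app' := hq }⟩

theorem hypSum_add_equivalent (a b : ℕ) :
    (hypSum F (a + b)).Equivalent ((hypSum F a).prod (hypSum F b)) := by
  refine ⟨{ (LinearEquiv.funCongrLeft F (F × F) finSumFinEquiv).trans
      (LinearEquiv.sumArrowLequivProdArrow (Fin a) (Fin b) F (F × F)) with
    map_app' := fun x => ?_ }⟩
  simp [hypSum_apply, Fin.sum_univ_add, LinearEquiv.sumArrowLequivProdArrow,
    LinearEquiv.funCongrLeft, Equiv.sumArrowEquivProdArrow]

theorem exists_qf_equivalent [FiniteDimensional F M] (q : QuadraticForm F M) :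
    ∃ q' : QF F (Module.finrank F M), q.Equivalent q' :=
  ⟨_, ⟨isometryEquivOfCompLinearEquiv q (Module.finBasis F M).equivFun.symm⟩⟩

theorem QuadraticMap.Equivalent.finrank_eq {q₁ : QuadraticForm F M} {q₂ : QuadraticForm F N}
    (h : q₁.Equivalent q₂) : Module.finrank F M = Module.finrank F N :=
  h.elim fun e => e.toLinearEquiv.finrank_eq

theorem polar_map {q₁ : QuadraticForm F M} {q₂ : QuadraticForm F N} (f : M →ₗ[F] N)
    (hf : ∀ x, q₂ (f x) = q₁ x) (x y : M) : polar q₂ (f x) (f y) = polar q₁ x y := by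
  simp only [polar, ← map_add, hf]

theorem Nonsingular.injective {q₁ : QuadraticForm F M} (h : Nonsingular F q₁)
    {q₂ : QuadraticForm F N} (f : M →ₗ[F] N)
    (hf : ∀ x y, polar q₂ (f x) (f y) = polar q₁ x y) : Function.Injective f := by
  refine (injective_iff_map_eq_zero f).2 fun x hx => h x fun y => ?_
  rw [← hf, hx, polar_zero_left]

theorem Nonsingular.of_equivalent {q₁ : QuadraticForm F M} {q₂ : QuadraticForm F N}
    (e : q₁.Equivalent q₂) (h : Nonsingular F q₁) : Nonsingular F q₂ := by
  obtain ⟨e⟩ := e.symm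
  intro x hx
  refine (map_eq_zero_iff e e.injective).1 (h _ fun y => ?_)
  have := polar_map (e : N →ₗ[F] M) e.map_app x (e.symm y)
  simp only [hx] at this
  simpa using this

theorem nonsingular_prod_iff {q₁ : QuadraticForm F M} {q₂ : QuadraticForm F N} :
    Nonsingular F (q₁.prod q₂) ↔ Nonsingular F q₁ ∧ Nonsingular F q₂ := by
  constructor
  · refine fun h => ⟨fun x hx => ?_, fun x hx => ?_⟩
    · exact (Prod.ext_iff.1 (h (x, 0) fun y => by simp [hx])).1
    · exact (Prod.ext_iff.1 (h (0, x) fun y => by simp [hx])).2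
  · rintro ⟨h₁, h₂⟩ x hx
    refine Prod.ext (h₁ _ fun y => ?_) (h₂ _ fun y => ?_)
    · simpa using hx (y, 0)
    · simpa using hx (0, y)

theorem Nonsingular.exists_polar_eq [FiniteDimensional F M] {q : QuadraticForm F M}
    (h : Nonsingular F q) (ℓ : Module.Dual F M) : ∃ a, ∀ x, polar q a x = ℓ x := by
  have hinj : Function.Injective q.polarBilin := by
    refine (injective_iff_map_eq_zero _).2 fun x hx => h x fun y => ?_
    have := LinearMap.congr_fun hx y
    simpa using this
  obtain ⟨a, ha⟩ := (LinearMap.injective_iff_surjective_of_finrank_eq_finrank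
    (Subspace.dual_finrank_eq (K := F) (V := M)).symm).1 hinj ℓ
  exact ⟨a, fun x => by rw [← ha]; simp⟩

/-- A nonsingular subform is an orthogonal summand. -/
theorem Nonsingular.exists_equivalent_prod [FiniteDimensional F M] [FiniteDimensional F N]
    {q₁ : QuadraticForm F M} (h : Nonsingular F q₁) {q₂ : QuadraticForm F N} (f : M →ₗ[F] N)
    (hf : ∀ x, q₂ (f x) = q₁ x) :
    ∃ (k : ℕ) (τ : QF F k), k + Module.finrank F M = Module.finrank F N ∧
      q₂.Equivalent (q₁.prod τ) := by
  let C : Submodule F N := LinearMap.ker (q₂.polarBilin.compl₂ f)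
  have hC : ∀ c : C, ∀ a, polar q₂ (f a) c = 0 := fun c a => by
    have := LinearMap.congr_fun (LinearMap.mem_ker.1 c.2) a
    rw [polar_comm]
    exact this
  let g : M × C →ₗ[F] N := f.coprod C.subtype
  have hg : ∀ x, q₂ (g x) = (q₁.prod (q₂.comp C.subtype)) x := fun x => by
    simp only [g, LinearMap.coprod_apply, QuadraticMap.prod_apply, QuadraticMap.comp_apply,
      Submodule.coe_subtype]
    rw [QuadraticMap.map_add q₂, hC, hf, add_zero]
  have hinj : Function.Injective g := by
    refine (injective_iff_map_eq_zero g).2 fun x hx => ?_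
    have hx' : f x.1 + x.2 = 0 := by simpa [g] using hx
    have h1 : x.1 = 0 := h _ fun y => by
      have h2 := hC x.2 y
      rw [polar_comm] at h2
      have h3 := polar_add_left q₂ (f x.1) x.2 (f y)
      rwa [hx', polar_zero_left, h2, add_zero, polar_map f hf, eq_comm] at h3
    refine Prod.ext h1 (Subtype.ext ?_)
    simpa [h1] using hx'
  have hsurj : Function.Surjective g := by
    intro b
    obtain ⟨a, ha⟩ := h.exists_polar_eq ((q₂.polarBilin b).comp f)
    have hb : b - f a ∈ C := by
      refine LinearMap.mem_ker.2 (LinearMap.ext fun x => ?_)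
      have := ha x
      simp only [LinearMap.comp_apply, polarBilin_apply_apply] at this
      simp only [LinearMap.compl₂_apply, polarBilin_apply_apply, polar_sub_left,
        polar_map f hf, this, sub_self, LinearMap.zero_apply]
    exact ⟨(a, ⟨b - f a, hb⟩), by simp [g]⟩
  have e : (q₁.prod (q₂.comp C.subtype)).Equivalent q₂ :=
    ⟨{ LinearEquiv.ofBijective g ⟨hinj, hsurj⟩ with map_app' := hg }⟩
  obtain ⟨τ, hτ⟩ := exists_qf_equivalent (q₂.comp C.subtype)
  refine ⟨_, τ, ?_, e.symm.trans ((Equivalent.refl q₁).prod hτ)⟩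
  rw [← e.finrank_eq, Module.finrank_prod, add_comm]

/-- Isometries act transitively on isotropic vectors which pair nontrivially. -/
theorem exists_isometryEquiv_apply_eq_of_polar_ne_zero {q : QuadraticForm F M} {x y : M}
    (hx : q x = 0) (hy : q y = 0) (hxy : polar q x y ≠ 0) :
    ∃ e : q.IsometryEquiv q, e x = y := by
  let v := x - y
  have hv : q v = - polar q x y := by
    have := QuadraticMap.map_add q x (-y)
    rw [QuadraticMap.map_neg, hx, hy, polar_neg_right] at this
    simp only [v, sub_eq_add_neg, this]; ring
  let r : M →ₗ[F] M :=
    LinearMap.id + LinearMap.smulRight (q.polarBilin v) ((polar q x y)⁻¹ • v)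
  have hr : ∀ z, r z = z + (polar q v z * (polar q x y)⁻¹) • v := fun z => by
    simp [r, smul_smul]
  have hvv : polar q v v = - (2 * polar q x y) := by
    rw [polar_self, hv]; simp
  have hrr : ∀ z, r (r z) = z := fun z => by
    rw [hr (r z), hr z, polar_add_right, polar_smul_right, hvv, add_assoc, ← add_smul]
    convert add_zero z
    rw [smul_eq_zero]; left
    simp only [smul_eq_mul]
    field_simp
    ring
  refine ⟨{ LinearEquiv.ofInvolutive r hrr with map_app' := fun z => ?_ }, ?_⟩
  · change q (r z) = q z
    rw [hr, QuadraticMap.map_add q, QuadraticMap.map_smul, polar_smul_right, hv, polar_comm q z v]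
    simp only [smul_eq_mul]
    field_simp
    ring
  · change r x = y
    have : polar q v x = - polar q x y := by
      simp only [v, polar_sub_left, polar_self, hx, polar_comm q y x]; simp
    rw [hr, this, neg_mul, mul_inv_cancel₀ hxy]
    simp [v]

theorem exists_polar_ne_zero {q : QuadraticForm F M} {x y x' y' : M}
    (hx : polar q x x' ≠ 0) (hy : polar q y y' ≠ 0) :
    ∃ z, polar q x z ≠ 0 ∧ polar q y z ≠ 0 := by
  by_cases h1 : polar q y x' = 0
  · by_cases h2 : polar q x y' = 0
    · exact ⟨x' + y', by simp [polar_add_right, h1, h2, hx, hy]⟩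
    · exact ⟨y', h2, hy⟩
  · exact ⟨x', hx, h1⟩

theorem exists_isometryEquiv_apply_eq {q : QuadraticForm F M} {x y x' y' : M}
    (hx : q x = 0) (hy : q y = 0) (hx' : polar q x x' ≠ 0) (hy' : polar q y y' ≠ 0) :
    ∃ e : q.IsometryEquiv q, e x = y := by
  by_cases hxy : polar q x y = 0
  · obtain ⟨z, hxz, hyz⟩ := exists_polar_ne_zero hx' hy'
    let w := z + (- q z * (polar q x z)⁻¹) • x
    have hw : q w = 0 := by
      simp only [w, QuadraticMap.map_add q, QuadraticMap.map_smul, polar_smul_right, hx,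
        polar_comm q z x, smul_eq_mul]
      field_simp
      ring
    have hxw : polar q x w ≠ 0 := by
      simpa [w, polar_add_right, polar_smul_right, polar_self, hx] using hxz
    have hwy : polar q w y ≠ 0 := by
      simpa [w, polar_add_left, polar_smul_left, hxy, polar_comm q z y] using hyz
    obtain ⟨e₁, h₁⟩ := exists_isometryEquiv_apply_eq_of_polar_ne_zero hx hw hxw
    obtain ⟨e₂, h₂⟩ := exists_isometryEquiv_apply_eq_of_polar_ne_zero hw hy hwy
    exact ⟨e₁.trans e₂, by change e₂ (e₁ x) = y; rw [h₁, h₂]⟩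
  · exact exists_isometryEquiv_apply_eq_of_polar_ne_zero hx hy hxy

theorem binForm_apply (a b : F) (x : F × F) :
    binForm a b x = a * (x.1 * x.1) + x.1 * x.2 + b * (x.2 * x.2) := by
  simp [binForm]

/-- Witt cancellation of a hyperbolic plane. -/
theorem equivalent_of_plane_prod [FiniteDimensional F M] [FiniteDimensional F N]
    {q₁ : QuadraticForm F M} {q₂ : QuadraticForm F N}
    (h : ((binForm (0 : F) 0).prod q₁).Equivalent ((binForm (0 : F) 0).prod q₂)) :
    q₁.Equivalent q₂ := by
  have hdim : Module.finrank F M = Module.finrank F N := by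
    have := h.finrank_eq
    simpa [Module.finrank_prod] using this
  obtain ⟨f⟩ := h
  have hpol : ∀ u v, polar ((binForm (0 : F) 0).prod q₂) (f u) (f v) =
      polar ((binForm (0 : F) 0).prod q₁) u v :=
    polar_map (f : (F × F) × M →ₗ[F] (F × F) × N) f.map_app
  have hb : ∀ u v : F × F, polar (binForm (0 : F) 0) u v = u.1 * v.2 + u.2 * v.1 := fun u v => by
    simp only [polar, binForm_apply, Prod.fst_add, Prod.snd_add]; ring
  obtain ⟨g, hg⟩ : ∃ g : ((binForm (0 : F) 0).prod q₂).IsometryEquiv ((binForm (0 : F) 0).prod q₂),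
      g (f ((1, 0), 0)) = ((1, 0), 0) := by
    refine exists_isometryEquiv_apply_eq (x' := f ((0, 1), 0)) (y' := ((0, 1), 0)) ?_ ?_ ?_ ?_
    · rw [f.map_app]; simp [binForm_apply]
    · simp [binForm_apply]
    · rw [hpol]; simp [hb]
    · simp [hb]
  let k := f.trans g
  have hk : k ((1, 0), 0) = ((1, 0), 0) := hg
  have hkpol : ∀ u v, polar ((binForm (0 : F) 0).prod q₂) (k u) (k v) =
      polar ((binForm (0 : F) 0).prod q₁) u v :=
    polar_map (k : (F × F) × M →ₗ[F] (F × F) × N) k.map_app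
  have hk2 : ∀ a : M, (k (0, a)).1.2 = 0 := fun a => by
    have := hkpol ((1, 0), 0) (0, a)
    rw [hk] at this
    simpa [hb] using this
  let kl : (F × F) × M →ₗ[F] (F × F) × N := k
  let β : M →ₗ[F] N := (LinearMap.snd F (F × F) N).comp (kl.comp (LinearMap.inr F (F × F) M))
  refine equivalent_of_injective β ?_ hdim fun a => ?_
  · refine (injective_iff_map_eq_zero β).2 fun a ha => ?_
    have h1 : k (0, a) = (k (0, a)).1.1 • ((1, 0), 0) := by
      refine Prod.ext (Prod.ext ?_ ?_) ?_
      · simp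
      · simp [hk2]
      · simpa using (show (k (0, a)).2 = 0 from ha)
    rw [← hk, ← map_smul] at h1
    exact (Prod.ext_iff.1 (k.injective h1)).2.trans (by simp)
  · have := k.map_app (0, a)
    rw [QuadraticMap.prod_apply, QuadraticMap.prod_apply, binForm_apply, binForm_apply, hk2] at this
    change q₂ (k (0, a)).2 = q₁ a
    simpa using this

theorem hypSum_one_equivalent : (hypSum F 1).Equivalent (binForm (0 : F) 0) :=
  ⟨{ LinearEquiv.funUnique (Fin 1) F (F × F) with
      map_app' := fun x => by simp [hypSum_apply, binForm_apply] }⟩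

theorem hypSum_zero_prod_equivalent (q : QuadraticForm F M) :
    ((hypSum F 0).prod q).Equivalent q :=
  ⟨{ LinearEquiv.uniqueProd (R := F) (M := M) (M₂ := Fin 0 → F × F) with
      map_app' := fun x => by simp [hypSum_apply] }⟩

/-- Witt cancellation of hyperbolic planes. -/
theorem equivalent_of_hypSum_prod [FiniteDimensional F M] [FiniteDimensional F N]
    {q₁ : QuadraticForm F M} {q₂ : QuadraticForm F N} (n : ℕ)
    (h : ((hypSum F n).prod q₁).Equivalent ((hypSum F n).prod q₂)) : q₁.Equivalent q₂ := by
  induction n with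
  | zero =>
    exact (hypSum_zero_prod_equivalent q₁).symm.trans (h.trans (hypSum_zero_prod_equivalent q₂))
  | succ n ih =>
    refine ih (equivalent_of_plane_prod ?_)
    have key : ∀ {L : Type} [AddCommGroup L] [Module F L] (q : QuadraticForm F L),
        ((hypSum F (n + 1)).prod q).Equivalent ((binForm (0 : F) 0).prod ((hypSum F n).prod q)) :=
      fun q => (((hypSum_add_equivalent n 1).prod (.refl q)).trans
        (prodAssoc_equivalent _ _ q)).trans ((prodLeftComm_equivalent _ _ q).trans
          (hypSum_one_equivalent.prod (.refl _)))
    exact (key q₁).symm.trans (h.trans (key q₂))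

theorem LinearMap.exists_apply_eq_one {v : M} (hv : v ≠ 0) : ∃ ℓ : Module.Dual F M, ℓ v = 1 := by
  obtain ⟨ℓ, hℓ⟩ := (LinearMap.toSpanSingleton F M v).exists_leftInverse_of_injective
    (LinearMap.ker_toSpanSingleton F hv)
  exact ⟨ℓ, by simpa using LinearMap.congr_fun hℓ 1⟩

theorem nonsingular_binForm_zero : Nonsingular F (binForm (0 : F) 0) := by
  intro x hx
  have h1 := hx (1, 0)
  have h2 := hx (0, 1)
  simp only [polar, binForm_apply, Prod.fst_add, Prod.snd_add] at h1 h2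
  refine Prod.ext ?_ ?_
  · change x.1 = 0; linear_combination h2
  · change x.2 = 0; linear_combination h1

/-- A vector in the quadratic radical splits off as a summand `⟨0⟩`. -/
theorem exists_equivalent_prod_zero [FiniteDimensional F M] {q : QuadraticForm F M} {v : M}
    (hv : v ≠ 0) (hq : q v = 0) (hp : ∀ w, polar q v w = 0) :
    ∃ (k : ℕ) (q' : QF F k), k < Module.finrank F M ∧
      q.Equivalent (q'.prod (0 : QF F 1)) := by
  obtain ⟨ℓ, hℓ⟩ := LinearMap.exists_apply_eq_one (F := F) hv
  let C := LinearMap.ker ℓ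
  let g : C × (Fin 1 → F) →ₗ[F] M :=
    C.subtype.coprod ((LinearMap.proj (0 : Fin 1)).smulRight v)
  have hg : ∀ x, g x = x.1 + x.2 0 • v := fun x => by simp [g]
  have hinj : Function.Injective g := by
    refine (injective_iff_map_eq_zero g).2 fun x hx => ?_
    rw [hg] at hx
    have h0 : x.2 0 = 0 := by
      have := congrArg ℓ hx
      rwa [map_add, LinearMap.mem_ker.1 x.1.2, map_smul, hℓ, zero_add, smul_eq_mul, mul_one,
        map_zero] at this
    refine Prod.ext (Subtype.ext ?_) (funext fun i => ?_)
    · simpa [h0] using hx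
    · rw [Subsingleton.elim i 0]; exact h0
  have hsurj : Function.Surjective g := fun b =>
    ⟨(⟨b - ℓ b • v, by simp [C, hℓ]⟩, fun _ => ℓ b), by simp [hg]⟩
  have e : ((q.comp C.subtype).prod (0 : QF F 1)).Equivalent q :=
    ⟨{ LinearEquiv.ofBijective g ⟨hinj, hsurj⟩ with
        map_app' := fun x => by
          change q (g x) = _
          rw [hg, QuadraticMap.map_add q, QuadraticMap.map_smul, hq, polar_smul_right, polar_comm,
            hp]
          simp }⟩
  obtain ⟨q', hq'⟩ := exists_qf_equivalent (q.comp C.subtype)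
  refine ⟨_, q', ?_, e.symm.trans (hq'.prod (.refl _))⟩
  have := e.finrank_eq
  rw [Module.finrank_prod, Module.finrank_fin_fun] at this
  omega

/-- An isotropic vector outside the radical of the polar form lies in a hyperbolic plane
which splits off. -/
theorem exists_equivalent_plane_prod [FiniteDimensional F M] {q : QuadraticForm F M} {v w : M}
    (hq : q v = 0) (hp : polar q v w ≠ 0) :
    ∃ (k : ℕ) (q' : QF F k), k < Module.finrank F M ∧
      q.Equivalent ((binForm (0 : F) 0).prod q') := by
  let w₁ := (polar q v w)⁻¹ • w
  have h₁ : polar q v w₁ = 1 := by simp [w₁, polar_smul_right, hp]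
  let w₂ := w₁ + (- q w₁) • v
  have h₂ : polar q v w₂ = 1 := by
    simp [w₂, polar_add_right, polar_smul_right, polar_self, hq, h₁]
  have hw₂ : q w₂ = 0 := by
    simp [w₂, QuadraticMap.map_add q, QuadraticMap.map_smul, polar_smul_right, hq,
      polar_comm q w₁ v, h₁]
  let f : F × F →ₗ[F] M :=
    ((LinearMap.id).smulRight v).coprod ((LinearMap.id).smulRight w₂)
  obtain ⟨k, τ, hk, e⟩ := nonsingular_binForm_zero.exists_equivalent_prod (q₂ := q) f fun x => by
    simp only [f, LinearMap.coprod_apply, LinearMap.smulRight_apply, LinearMap.id_apply]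
    rw [QuadraticMap.map_add q, QuadraticMap.map_smul, QuadraticMap.map_smul, hq, hw₂,
      polar_smul_left, polar_smul_right, h₂]
    simp [binForm_apply]
  refine ⟨k, τ, ?_, e⟩
  rw [Module.finrank_prod, Module.finrank_self] at hk
  omega

theorem zero_prod_zero_equivalent (a b : ℕ) :
    ((0 : QF F a).prod (0 : QF F b)).Equivalent (0 : QF F (a + b)) :=
  ⟨{ ((LinearEquiv.funCongrLeft F F finSumFinEquiv).trans
      (LinearEquiv.sumArrowLequivProdArrow (Fin a) (Fin b) F F)).symm with
    map_app' := fun x => by simp }⟩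

theorem hypSum_prod_prod_prod_equivalent (m i : ℕ) (ρ : QuadraticForm F M)
    (ζ : QuadraticForm F N) :
    ((hypSum F m).prod (((hypSum F i).prod ρ).prod ζ)).Equivalent
      (((hypSum F (m + i)).prod ρ).prod ζ) := by
  have h₁ := (prodAssoc_equivalent (hypSum F m) ((hypSum F i).prod ρ) ζ).symm
  have h₂ := (prodAssoc_equivalent (hypSum F m) (hypSum F i) ρ).symm
  have h₃ := (hypSum_add_equivalent (F := F) m i).symm.prod (Equivalent.refl ρ)
  exact h₁.trans ((h₂.trans h₃).prod (Equivalent.refl ζ))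

/-- Witt decomposition of a quadratic form. -/
theorem exists_witt_decomposition {m : ℕ} (q : QF F m) :
    ∃ (i r j : ℕ) (ρ : QF F r), ρ.Anisotropic ∧
      q.Equivalent (((hypSum F i).prod ρ).prod (0 : QF F j)) := by
  induction m using Nat.strong_induction_on with
  | _ m ih =>
  by_cases hq : q.Anisotropic
  · exact ⟨0, m, 0, q, hq, (hypSum_zero_prod_equivalent q).symm.trans
      ⟨{ (LinearEquiv.prodUnique (R := F) (M := (Fin 0 → F × F) × (Fin m → F))
          (M₂ := Fin 0 → F)).symm with map_app' := fun x => by simp }⟩⟩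
  obtain ⟨v, hv, hv0⟩ : ∃ v, q v = 0 ∧ v ≠ 0 := by
    simpa [QuadraticMap.Anisotropic] using hq
  by_cases hp : ∀ w, polar q v w = 0
  · obtain ⟨k, q', hk, e⟩ := exists_equivalent_prod_zero hv0 hv hp
    rw [Module.finrank_fin_fun] at hk
    obtain ⟨i, r, j, ρ, hρ, e'⟩ := ih k hk q'
    exact ⟨i, r, j + 1, ρ, hρ, e.trans ((e'.prod (Equivalent.refl (0 : QF F 1))).trans
      ((prodAssoc_equivalent _ _ _).trans ((Equivalent.refl ((hypSum F i).prod ρ)).prod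
        (zero_prod_zero_equivalent j 1))))⟩
  · obtain ⟨w, hw⟩ := not_forall.1 hp
    obtain ⟨k, q', hk, e⟩ := exists_equivalent_plane_prod hv hw
    rw [Module.finrank_fin_fun] at hk
    obtain ⟨i, r, j, ρ, hρ, e'⟩ := ih k hk q'
    exact ⟨1 + i, r, j, ρ, hρ, e.trans ((hypSum_one_equivalent.symm.prod e').trans
      (hypSum_prod_prod_prod_equivalent 1 i ρ 0))⟩

theorem diagQF_zero (j : ℕ) : diagQF F (0 : Fin j → F) = 0 := by
  ext x; simp [diagQF_apply]

theorem wittEquiv_form_equivalent {i r j : ℕ} (ρ : QF F r) :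
    (oSum F (oSum F (oSumFam F fun _ : Fin i => binQF F 0 0) ρ)
      (diagQF F (0 : Fin j → F))).Equivalent (((hypSum F i).prod ρ).prod (0 : QF F j)) := by
  rw [diagQF_zero]
  exact (oSum_equivalent_prod _ _).trans (((oSum_equivalent_prod _ _).trans
    ((oSumFam_hyp_equivalent i).prod (.refl ρ))).prod (.refl _))

theorem wittEquiv_of_equivalent_hypSum_prod [FiniteDimensional F N] {q₁ : QuadraticForm F M}
    {q₂ : QuadraticForm F N} (m : ℕ) (h : q₁.Equivalent ((hypSum F m).prod q₂)) :
    WittEquiv F q₁ q₂ := by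
  obtain ⟨q, hq⟩ := exists_qf_equivalent q₂
  obtain ⟨i, r, j, ρ, hρ, e⟩ := exists_witt_decomposition q
  refine ⟨r, ρ, hρ, ⟨m + i, j, ?_⟩, ⟨i, j, (hq.trans e).trans (wittEquiv_form_equivalent ρ).symm⟩⟩
  exact (h.trans (((Equivalent.refl _).prod (hq.trans e)).trans
    (hypSum_prod_prod_prod_equivalent m i ρ 0))).trans (wittEquiv_form_equivalent ρ).symm

/-- The dimension of the radical of the polar form. -/
noncomputable def radDim (q : QuadraticForm F M) : ℕ :=
  Module.finrank F (LinearMap.ker q.polarBilin)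

theorem mem_ker_polarBilin {q : QuadraticForm F M} {x : M} :
    x ∈ LinearMap.ker q.polarBilin ↔ ∀ y, polar q x y = 0 := by
  simp [LinearMap.ext_iff]

theorem radDim_eq_of_equivalent {q₁ : QuadraticForm F M} {q₂ : QuadraticForm F N}
    (h : q₁.Equivalent q₂) : radDim q₁ = radDim q₂ := by
  obtain ⟨e⟩ := h
  refine (e.toLinearEquiv.ofSubmodules _ _ ?_).finrank_eq
  ext x
  rw [Submodule.mem_map_equiv, mem_ker_polarBilin, mem_ker_polarBilin]
  have h : ∀ u v, polar q₂ (e u) (e v) = polar q₁ u v := polar_map (e : M →ₗ[F] N) e.map_app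
  change (∀ y, polar q₁ (e.symm x) y = 0) ↔ _
  refine ⟨fun H y => ?_, fun H y => ?_⟩
  · simpa [H] using h (e.symm x) (e.symm y)
  · simpa [H] using (h (e.symm x) y).symm

theorem radDim_prod [FiniteDimensional F M] [FiniteDimensional F N] (q₁ : QuadraticForm F M)
    (q₂ : QuadraticForm F N) : radDim (q₁.prod q₂) = radDim q₁ + radDim q₂ := by
  have : LinearMap.ker (q₁.prod q₂).polarBilin =
      (LinearMap.ker q₁.polarBilin).prod (LinearMap.ker q₂.polarBilin) := by
    ext x
    rw [Submodule.mem_prod, mem_ker_polarBilin, mem_ker_polarBilin, mem_ker_polarBilin]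
    refine ⟨fun h => ⟨fun y => by simpa using h (y, 0), fun y => by simpa using h (0, y)⟩,
      fun h y => by simp [h.1, h.2]⟩
  let e : ((LinearMap.ker q₁.polarBilin).prod (LinearMap.ker q₂.polarBilin)) ≃ₗ[F]
      LinearMap.ker q₁.polarBilin × LinearMap.ker q₂.polarBilin :=
    { toFun := fun x => (⟨x.1.1, x.2.1⟩, ⟨x.1.2, x.2.2⟩)
      invFun := fun x => ⟨(x.1.1, x.2.1), x.1.2, x.2.2⟩
      map_add' := fun _ _ => rfl
      map_smul' := fun _ _ => rfl }
  rw [radDim, this, e.finrank_eq, Module.finrank_prod]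
  rfl

theorem Nonsingular.radDim_eq_zero {q : QuadraticForm F M} (h : Nonsingular F q) :
    radDim q = 0 := by
  have : LinearMap.ker q.polarBilin = ⊥ :=
    (Submodule.eq_bot_iff _).2 fun x hx => h x (mem_ker_polarBilin.1 hx)
  rw [radDim, this, finrank_bot]

theorem radDim_zero (j : ℕ) : radDim (0 : QF F j) = j := by
  have : LinearMap.ker (0 : QF F j).polarBilin = ⊤ :=
    eq_top_iff.2 fun x _ => mem_ker_polarBilin.2 fun y => by simp [polar]
  rw [radDim, this, finrank_top, Module.finrank_fin_fun]

theorem exists_linearIndependent_of_forall_dual [FiniteDimensional F M] {m : ℕ}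
    (hm : m ≤ Module.finrank F M) (p : Fin m → M → Prop)
    (hp : ∀ i, ∀ ℓ : Module.Dual F M, ℓ ≠ 0 → ∃ w, p i w ∧ ℓ w ≠ 0) :
    ∃ w : Fin m → M, LinearIndependent F w ∧ ∀ i, p i (w i) := by
  induction m with
  | zero => exact ⟨Fin.elim0, linearIndependent_empty_type, fun i => i.elim0⟩
  | succ m ih =>
    obtain ⟨w, hw, hpw⟩ := ih (by omega) (fun i => p i.castSucc) fun i => hp _
    have hlt : Submodule.span F (Set.range w) < ⊤ := by
      refine lt_top_iff_ne_top.2 fun h => ?_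
      have := finrank_span_eq_card hw
      rw [h, finrank_top, Fintype.card_fin] at this
      omega
    obtain ⟨ℓ, hℓ, hle⟩ := Submodule.exists_le_ker_of_lt_top _ hlt
    obtain ⟨v, hv, hℓv⟩ := hp (Fin.last m) ℓ hℓ
    refine ⟨Fin.snoc w v, linearIndependent_finSnoc.2
      ⟨hw, fun h => hℓv (LinearMap.mem_ker.1 (hle h))⟩, fun i => ?_⟩
    refine Fin.lastCases ?_ (fun j => ?_) i
    · simpa using hv
    · simpa using hpw j

theorem map_sum_of_polar_eq_zero {ι : Type} (q : QuadraticForm F M) (s : Finset ι) (f : ι → M)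
    (h : ∀ i j, i ≠ j → polar q (f i) (f j) = 0) : q (∑ i ∈ s, f i) = ∑ i ∈ s, q (f i) := by
  classical
  induction s using Finset.induction_on with
  | empty => simp
  | insert a s ha ih =>
    have h0 : polar q (f a) (∑ i ∈ s, f i) = 0 := by
      rw [← polarBilin_apply_apply, map_sum]
      exact Finset.sum_eq_zero fun i hi => h _ _ fun e => ha (e ▸ hi)
    rw [Finset.sum_insert ha, Finset.sum_insert ha, QuadraticMap.map_add q, ih, h0, add_zero]

theorem dominates_prod_diagQF {n : ℕ} {φ : QuadraticForm F M} {ψ : QuadraticForm F N}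
    {τ : QuadraticForm F P} {c d : Fin n → F}
    (h : ψ.Equivalent ((φ.prod (binSum c d)).prod τ)) :
    Dominates F (φ.prod (diagQF F c)) ψ := by
  obtain ⟨e⟩ := h.symm
  let f : M × (Fin n → F) →ₗ[F] (M × (Fin n → F × F)) × P :=
    (LinearMap.inl F _ _).comp (LinearMap.id.prodMap (LinearMap.pi fun i =>
      (LinearMap.inl F F F).comp (LinearMap.proj i)))
  have hf : ∀ x, f x = ((x.1, fun i => (x.2 i, 0)), 0) := fun x => rfl
  refine ⟨(e.toLinearEquiv : _ →ₗ[F] N).comp f, e.injective.comp ?_, fun x => ?_⟩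
  · refine (injective_iff_map_eq_zero f).2 fun x hx => ?_
    rw [hf] at hx
    exact Prod.ext (congrArg (fun y => y.1.1) hx)
      (funext fun i => congrArg (fun y => (y.1.2 i).1) hx)
  · refine Eq.trans ?_ (e.map_app _).symm
    simp [hf, diagQF_apply, binSum_apply]

theorem Dominates.congr_left {q₁ : QuadraticForm F M} {q₂ : QuadraticForm F N}
    {q : QuadraticForm F P} (e : q₁.Equivalent q₂) (h : Dominates F q₁ q) :
    Dominates F q₂ q := by
  obtain ⟨e⟩ := e.symm
  obtain ⟨t, ht, hq⟩ := h
  exact ⟨t.comp (e.toLinearEquiv : N →ₗ[F] M), ht.comp e.injective,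
    fun x => (e.map_app x).symm.trans (hq _)⟩

section CharTwo
variable [CharP F 2]

theorem diagQF_add {n : ℕ} (c x y : Fin n → F) :
    diagQF F c (x + y) = diagQF F c x + diagQF F c y := by
  simp only [diagQF_apply, ← Finset.sum_add_distrib, Pi.add_apply]
  refine Finset.sum_congr rfl fun i _ => ?_
  linear_combination (c i * x i * y i) * CharTwo.two_eq_zero (R := F)

theorem polar_diagQF {n : ℕ} (c x y : Fin n → F) : polar (diagQF F c) x y = 0 := by
  rw [polar, diagQF_add]; ring

theorem diagQF_sum_smul {n m : ℕ} (c : Fin n → F) (t : Fin m → F) (w : Fin m → Fin n → F) :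
    diagQF F c (∑ i, t i • w i) = ∑ i, t i * t i * diagQF F c (w i) := by
  have := map_sum (AddMonoidHom.mk' (diagQF F c) (diagQF_add c)) (fun i => t i • w i)
    Finset.univ
  refine this.trans (Finset.sum_congr rfl fun i _ => ?_)
  change diagQF F c (t i • w i) = _
  rw [QuadraticMap.map_smul, smul_eq_mul]

theorem polar_binSum {n : ℕ} (c d : Fin n → F) (x y : Fin n → F × F) :
    polar (binSum c d) x y = ∑ i, ((x i).1 * (y i).2 + (x i).2 * (y i).1) := by
  simp only [polar, binSum_apply, ← Finset.sum_sub_distrib]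
  refine Finset.sum_congr rfl fun i _ => ?_
  simp only [Pi.add_apply, Prod.fst_add, Prod.snd_add]
  linear_combination (c i * (x i).1 * (y i).1 + d i * (x i).2 * (y i).2) *
    CharTwo.two_eq_zero (R := F)

theorem nonsingular_binSum {n : ℕ} (c d : Fin n → F) : Nonsingular F (binSum c d) := by
  intro x hx
  funext i
  refine Prod.ext ?_ ?_
  · simpa [polar_binSum, Pi.single_apply, apply_ite Prod.fst, apply_ite Prod.snd] using
      hx (Pi.single i (0, 1))
  · simpa [polar_binSum, Pi.single_apply, apply_ite Prod.fst, apply_ite Prod.snd] using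
      hx (Pi.single i (1, 0))

/-- In characteristic two the double of a nonsingular form is hyperbolic. -/
theorem Nonsingular.prod_self_equivalent {m : ℕ} {φ : QF F m} (h : Nonsingular F φ) :
    (φ.prod φ).Equivalent (hypSum F m) := by
  let B := φ.toBilin (Pi.basisFun F (Fin m))
  have hB : ∀ x, B x x = φ x := fun x => by
    rw [← LinearMap.BilinMap.toQuadraticMap_apply, QuadraticMap.toQuadraticMap_toBilin]
  let s : (Fin m → F) × (Fin m → F) →ₗ[F] Fin m → F :=
    LinearMap.fst F _ _ + LinearMap.snd F _ _
  let L : (Fin m → F) × (Fin m → F) →ₗ[F] Module.Dual F (Fin m → F) :=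
    φ.polarBilin.comp (LinearMap.snd F _ _) + B.comp s
  let f : (Fin m → F) × (Fin m → F) →ₗ[F] Fin m → F × F :=
    LinearMap.pi fun i => ((LinearMap.applyₗ (Pi.single i 1)).comp L).prod
      ((LinearMap.proj i).comp s)
  have hf1 : ∀ p i, (f p i).1 = L p (Pi.single i 1) := fun p i => rfl
  have hf2 : ∀ p i, (f p i).2 = s p i := fun p i => rfl
  have hL : ∀ p z, L p z = polar φ p.2 z + B (s p) z := fun p z => rfl
  have hs : ∀ p, s p = p.1 + p.2 := fun p => rfl
  refine equivalent_of_injective f ?_ ?_ fun p => ?_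
  · refine (injective_iff_map_eq_zero f).2 fun p hp => ?_
    have h1 : s p = 0 := funext fun i => by rw [← hf2, hp]; rfl
    have h2 : L p = 0 := LinearMap.pi_ext' fun i => LinearMap.ext_ring (by
      change L p (Pi.single i 1) = 0
      rw [← hf1, hp]; rfl)
    have h3 : p.2 = 0 := h _ fun y => by
      have := hL p y
      rw [h2, h1, map_zero] at this
      simpa using this.symm
    rw [hs, h3, add_zero] at h1
    exact Prod.ext h1 h3
  · simp [Module.finrank_prod, Module.finrank_pi_fintype, mul_two]
  · have h1 : hypSum F m (f p) = L p (s p) := by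
      rw [hypSum_apply, LinearMap.pi_apply_eq_sum_univ (L p) (s p)]
      refine Finset.sum_congr rfl fun i _ => ?_
      rw [hf1, hf2, smul_eq_mul, mul_comm]
      congr 2
      funext j; simp [Pi.single_apply, eq_comm]
    rw [h1, hL, hB, hs, QuadraticMap.prod_apply, QuadraticMap.map_add φ, polar_add_right,
      polar_self, polar_comm φ p.2 p.1]
    simp only [nsmul_eq_mul, Nat.cast_ofNat]
    linear_combination (φ p.2 + polar φ p.1 p.2) * CharTwo.two_eq_zero (R := F)

theorem binSum_prod_diagQF_equivalent {n : ℕ} (c d : Fin n → F) :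
    ((binSum c d).prod (diagQF F c)).Equivalent ((hypSum F n).prod (diagQF F c)) := by
  let f : (Fin n → F × F) × (Fin n → F) →ₗ[F] (Fin n → F × F) × (Fin n → F) :=
    { toFun := fun p => (fun i => ((p.1 i).1 + d i * (p.1 i).2, (p.1 i).2),
        fun i => p.2 i + (p.1 i).1)
      map_add' := fun p q => by
        ext i <;> simp <;> ring
      map_smul' := fun t p => by
        ext i <;> simp <;> ring }
  refine equivalent_of_injective f ?_ rfl fun p => ?_
  · refine (injective_iff_map_eq_zero f).2 fun p hp => ?_
    have h2 : ∀ i, (p.1 i).2 = 0 := fun i => (Prod.ext_iff.1 (congrFun (congrArg Prod.fst hp) i)).2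
    have h1 : ∀ i, (p.1 i).1 = 0 := fun i => by
      have : (p.1 i).1 + d i * (p.1 i).2 = 0 :=
        (Prod.ext_iff.1 (congrFun (congrArg Prod.fst hp) i)).1
      simpa [h2] using this
    have h3 : ∀ i, p.2 i = 0 := fun i => by
      have : p.2 i + (p.1 i).1 = 0 := congrFun (congrArg Prod.snd hp) i
      simpa [h1] using this
    exact Prod.ext (funext fun i => Prod.ext (h1 i) (h2 i)) (funext h3)
  · simp only [QuadraticMap.prod_apply, binSum_apply, diagQF_apply, Pi.zero_apply,
      ← Finset.sum_add_distrib, f, LinearMap.coe_mk, AddHom.coe_mk]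
    refine Finset.sum_congr rfl fun i _ => ?_
    linear_combination (c i * p.2 i * (p.1 i).1) * CharTwo.two_eq_zero (R := F)

/-- If the hyperbolic form `n × ℍ` is twisted by adding `σ ∘ h` for a totally singular form
`σ` of dimension `n`, the resulting form still dominates `σ`. -/
theorem exists_hypSum_add_diagQF_eq {n : ℕ} (c : Fin n → F)
    (h : (Fin n → F × F) →ₗ[F] Fin n → F) :
    ∃ s : (Fin n → F) →ₗ[F] Fin n → F × F, Function.Injective s ∧
      ∀ z, hypSum F n (s z) + diagQF F c (h (s z)) = diagQF F c z := by
  obtain ⟨w, hw, hpw⟩ := exists_linearIndependent_of_forall_dual (F := F) (M := Fin n → F)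
    (m := n) (by simp)
    (fun i w => ∃ p : F × F, p ≠ 0 ∧ p.1 * p.2 + diagQF F c (h (Pi.single i p)) = diagQF F c w)
    (fun i ℓ hℓ => by
      have hsplit : ∀ x y : F, h (Pi.single i (x, y)) =
          x • h (Pi.single i (1, 0)) + y • h (Pi.single i (0, 1)) := fun x y => by
        rw [← map_smul, ← map_smul, ← map_add, ← Pi.single_smul, ← Pi.single_smul,
          ← Pi.single_add]
        simp
      by_cases hb : ℓ (h (Pi.single i (0, 1))) = 0
      · obtain ⟨u, hu⟩ : ∃ u, ℓ u + ℓ (h (Pi.single i (1, 0))) ≠ 0 := by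
          by_cases ha : ℓ (h (Pi.single i (1, 0))) = 0
          · obtain ⟨u, hu⟩ := DFunLike.exists_ne hℓ
            exact ⟨u, by simpa [ha] using hu⟩
          · exact ⟨0, by simpa using ha⟩
        refine ⟨u + h (Pi.single i (1, diagQF F c u)), ⟨(1, diagQF F c u), by simp, ?_⟩, ?_⟩
        · rw [diagQF_add, one_mul]
        · rw [hsplit, map_add, map_add, map_smul, map_smul, hb]
          simpa using hu
      · exact ⟨_, ⟨(0, 1), by simp, by simp⟩, hb⟩)
  choose p hp0 hp using hpw
  let b := Module.Basis.mk hw (hw.span_eq_top_of_card_eq_finrank' (by simp)).ge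
  have hb : ∀ z, ∑ i, b.equivFun z i • w i = z := fun z => by
    have := b.sum_equivFun z
    simpa [b] using this
  let s : (Fin n → F) →ₗ[F] Fin n → F × F :=
    (LinearMap.pi fun i => (LinearMap.proj i).smulRight (p i)).comp
      (b.equivFun : (Fin n → F) →ₗ[F] Fin n → F)
  have hs : ∀ z i, s z i = b.equivFun z i • p i := fun z i => rfl
  refine ⟨s, (injective_iff_map_eq_zero s).2 fun z hz => ?_, fun z => ?_⟩
  · refine b.equivFun.map_eq_zero_iff.1 (funext fun i => ?_)
    have := hs z i
    rw [hz] at this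
    exact (smul_eq_zero.1 this.symm).resolve_right (hp0 i)
  · have hs' : s z = ∑ i, b.equivFun z i • Pi.single i (p i) := by
      funext j
      rw [hs, Finset.sum_apply]
      simp [Pi.single_apply]
    have h1 : diagQF F c (h (s z)) =
        ∑ i, b.equivFun z i * b.equivFun z i * diagQF F c (h (Pi.single i (p i))) := by
      rw [hs', map_sum, ← diagQF_sum_smul]
      simp only [map_smul]
    have h2 : hypSum F n (s z) = ∑ i, b.equivFun z i * b.equivFun z i * ((p i).1 * (p i).2) := by
      rw [hypSum_apply]
      refine Finset.sum_congr rfl fun i _ => ?_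
      rw [hs]
      simp only [Prod.smul_fst, Prod.smul_snd, smul_eq_mul]
      ring
    rw [h1, h2, ← Finset.sum_add_distrib]
    conv_rhs => rw [← hb z, diagQF_sum_smul]
    exact Finset.sum_congr rfl fun i _ => by rw [← hp i]; ring

theorem exists_isometry_prod_binSum [FiniteDimensional F N] {n : ℕ} {φ : QuadraticForm F M}
    {ψ : QuadraticForm F N} (hψ : Nonsingular F ψ) (c : Fin n → F)
    (t : M × (Fin n → F) →ₗ[F] N) (ht : Function.Injective t)
    (hq : ∀ v, ψ (t v) = (φ.prod (diagQF F c)) v) :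
    ∃ (d : Fin n → F) (g : M × (Fin n → F × F) →ₗ[F] N),
      ∀ x, ψ (g x) = (φ.prod (binSum c d)) x := by
  obtain ⟨r, hr⟩ := t.exists_leftInverse_of_injective (LinearMap.ker_eq_bot.2 ht)
  have hr' : ∀ v, r (t v) = v := LinearMap.congr_fun hr
  choose w hw using fun j =>
    hψ.exists_polar_eq ((LinearMap.proj j).comp ((LinearMap.snd F M (Fin n → F)).comp r))
  have hwt : ∀ j x, ψ.polarBilin (w j) (t x) = x.2 j := fun j x => by
    rw [polarBilin_apply_apply, hw]
    simp [hr']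
  let v : Fin n → N := fun i => t (0, Pi.single i 1)
  have hvt : ∀ i x, ψ.polarBilin (v i) (t x) = 0 := fun i x => by
    rw [polarBilin_apply_apply, polar_map t hq, polar_prod]
    simp [polar_diagQF]
  have hsymm : ∀ x y, ψ.polarBilin x y = ψ.polarBilin y x := fun x y => polar_comm ψ x y
  let u : Fin n → N := fun j => w j + ∑ i ∈ Finset.Iio j, ψ.polarBilin (w i) (w j) • v i
  have hut : ∀ j x, ψ.polarBilin (u j) (t x) = x.2 j := fun j x => by
    simp [u, -polarBilin_apply_apply, hwt, hvt]
  have huw : ∀ i j, i < j → ψ.polarBilin (u i) (w j) = ψ.polarBilin (w i) (w j) :=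
    fun i j hij => by
      have : ∀ k ∈ Finset.Iio i, ψ.polarBilin (w k) (w i) * ψ.polarBilin (v k) (w j) = 0 :=
        fun k hk => by
          have hkj : j ≠ k := ((Finset.mem_Iio.1 hk).trans hij).ne'
          rw [hsymm (v k), hwt]
          simp [hkj]
      simp only [u, map_add, map_sum, LinearMap.add_apply, LinearMap.sum_apply, map_smul,
        LinearMap.smul_apply, smul_eq_mul]
      rw [Finset.sum_eq_zero this, add_zero]
  have huv : ∀ i k, ψ.polarBilin (u i) (v k) = if i = k then 1 else 0 := fun i k => by
    rw [hut]; exact Pi.single_apply ..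
  have huu_lt : ∀ i j, i < j → ψ.polarBilin (u i) (u j) = 0 := fun i j hij => by
    have : ψ.polarBilin (u i) (u j) =
        ψ.polarBilin (u i) (w j + ∑ k ∈ Finset.Iio j, ψ.polarBilin (w k) (w j) • v k) := rfl
    rw [this, map_add, map_sum, huw i j hij]
    simp only [map_smul, huv, smul_eq_mul, mul_ite, mul_one, mul_zero]
    rw [Finset.sum_ite_eq, if_pos (Finset.mem_Iio.2 hij)]
    exact CharTwo.add_self_eq_zero _
  have huu : ∀ i j, i ≠ j → ψ.polarBilin (u i) (u j) = 0 := fun i j hij =>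
    hij.lt_or_gt.elim (huu_lt i j) fun h => (hsymm _ _).trans (huu_lt j i h)
  refine ⟨fun i => ψ (u i),
    { toFun := fun x => t (x.1, fun i => (x.2 i).1) + ∑ i, (x.2 i).2 • u i
      map_add' := fun x y => ?_
      map_smul' := fun a x => ?_ }, fun x => ?_⟩
  · have : (x.1 + y.1, fun i => ((x + y).2 i).1) =
        (x.1, fun i => (x.2 i).1) + (y.1, fun i => (y.2 i).1) := rfl
    rw [Prod.fst_add, this, map_add]
    simp only [Prod.snd_add, Pi.add_apply, add_smul, Finset.sum_add_distrib]
    abel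
  · have : ((a • x).1, fun i => ((a • x).2 i).1) = a • (x.1, fun i => (x.2 i).1) := rfl
    rw [this, map_smul]
    simp [Finset.smul_sum, smul_smul]
  · change ψ (t (x.1, fun i => (x.2 i).1) + ∑ i, (x.2 i).2 • u i) = _
    have h1 : polar ψ (t (x.1, fun i => (x.2 i).1)) (∑ i, (x.2 i).2 • u i) =
        ∑ i, (x.2 i).1 * (x.2 i).2 := by
      rw [← polarBilin_apply_apply, hsymm, map_sum, LinearMap.sum_apply]
      refine Finset.sum_congr rfl fun i _ => ?_
      rw [map_smul, LinearMap.smul_apply, hut, smul_eq_mul, mul_comm]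
    have h2 : ψ (∑ i, (x.2 i).2 • u i) = ∑ i, ψ (u i) * ((x.2 i).2 * (x.2 i).2) := by
      rw [map_sum_of_polar_eq_zero]
      · refine Finset.sum_congr rfl fun i _ => ?_
        rw [QuadraticMap.map_smul, smul_eq_mul, mul_comm]
      · intro i j hij
        have := huu i j hij
        rw [← polarBilin_apply_apply, map_smul, map_smul, LinearMap.smul_apply, this]
        simp
    rw [QuadraticMap.map_add ψ, h1, h2, hq]
    simp only [QuadraticMap.prod_apply, diagQF_apply, binSum_apply, Finset.sum_add_distrib]
    ring

theorem prod_prod_diagQF_equivalent {m n : ℕ} {φ : QF F m} (hφ : Nonsingular F φ)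
    {ψ : QuadraticForm F M} {τ : QuadraticForm F N} {c d : Fin n → F}
    (h : ψ.Equivalent ((φ.prod (binSum c d)).prod τ)) :
    ((ψ.prod φ).prod (diagQF F c)).Equivalent
      ((hypSum F (m + n)).prod (τ.prod (diagQF F c))) := by
  have h₁ : ((ψ.prod φ).prod (diagQF F c)).Equivalent
      ((φ.prod φ).prod (((binSum c d).prod (diagQF F c)).prod τ)) := by
    obtain ⟨e⟩ := h
    refine ⟨{ toFun := fun x => ((x.1.2, (e x.1.1).1.1), (((e x.1.1).1.2, x.2), (e x.1.1).2))
              invFun := fun y => ((e.symm ((y.1.2, y.2.1.1), y.2.2), y.1.1), y.2.1.2)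
              left_inv := fun x => by simp
              right_inv := fun y => by simp
              map_add' := fun x y => by simp
              map_smul' := fun a x => by simp
              map_app' := fun x => ?_ }⟩
    have := e.map_app x.1.1
    simp only [QuadraticMap.prod_apply] at this ⊢
    rw [← this]
    ring
  have h₂ := hφ.prod_self_equivalent.prod
    ((binSum_prod_diagQF_equivalent c d).prod (Equivalent.refl τ))
  have h₃ := (Equivalent.refl (hypSum F m)).prod ((prodAssoc_equivalent (hypSum F n)
    (diagQF F c) τ).trans ((Equivalent.refl _).prod (prodComm_equivalent _ _)))
  exact (h₁.trans (h₂.trans h₃)).trans ((prodAssoc_equivalent _ _ _).symm.trans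
    ((hypSum_add_equivalent m n).symm.prod (.refl _)))

theorem dominates_of_hypSum_prod_equivalent {n : ℕ} {φ : QuadraticForm F M}
    {τ : QuadraticForm F P} (hφ : Nonsingular F φ) (hτ : Nonsingular F τ)
    {ψ : QuadraticForm F N} (c : Fin n → F)
    (h : (((hypSum F n).prod (φ.prod τ)).prod (diagQF F c)).Equivalent
      (ψ.prod (diagQF F c))) :
    Dominates F (φ.prod (diagQF F c)) ψ := by
  obtain ⟨e⟩ := h
  let X := (hypSum F n).prod (φ.prod τ)
  have hX : Nonsingular F X :=
    nonsingular_prod_iff.2 ⟨nonsingular_binSum 0 0, nonsingular_prod_iff.2 ⟨hφ, hτ⟩⟩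
  let e' : ((Fin n → F × F) × (M × P)) →ₗ[F] N × (Fin n → F) :=
    e.toLinearEquiv.toLinearMap.comp (LinearMap.inl F _ _)
  let p := (LinearMap.fst F _ _).comp e'
  let k := (LinearMap.snd F _ _).comp e'
  have hpk : ∀ x, ψ (p x) = X x + diagQF F c (k x) := fun x => by
    have h1 : ψ (p x) + diagQF F c (k x) = X x := by
      refine (e.map_app (x, 0)).trans ?_
      simp [X]
    rw [← h1, add_assoc, CharTwo.add_self_eq_zero, add_zero]
  have hp : Function.Injective p := by
    refine hX.injective (q₂ := ψ) p fun x y => ?_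
    simp only [polar, ← map_add p, hpk, map_add k, diagQF_add]
    ring
  let k₁ := k.comp (LinearMap.inl F (Fin n → F × F) (M × P))
  let k₂ := (k.comp (LinearMap.inr F (Fin n → F × F) (M × P))).comp (LinearMap.inl F M P)
  have hk : ∀ y x, k (y, (x, 0)) = k₁ y + k₂ x := fun y x => by
    change _ = k (y, 0) + k (0, (x, 0))
    rw [← map_add]; simp
  obtain ⟨s, hs, hs'⟩ := exists_hypSum_add_diagQF_eq c k₁
  let s' : M × (Fin n → F) →ₗ[F] (Fin n → F × F) × (M × P) :=
    (s.comp (LinearMap.snd F _ _ + k₂.comp (LinearMap.fst F _ _))).prod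
      ((LinearMap.inl F M P).comp (LinearMap.fst F _ _))
  have hs'_apply : ∀ x, s' x = (s (x.2 + k₂ x.1), (x.1, 0)) := fun x => rfl
  refine ⟨p.comp s', hp.comp ((injective_iff_map_eq_zero s').2 fun x hx => ?_), fun x => ?_⟩
  · rw [hs'_apply] at hx
    have h1 : x.1 = 0 := congrArg (fun y => y.2.1) hx
    have h2 : s (x.2 + k₂ x.1) = 0 := congrArg Prod.fst hx
    rw [h1, map_zero, add_zero] at h2
    exact Prod.ext h1 ((map_eq_zero_iff s hs).1 h2)
  · rw [LinearMap.comp_apply, hpk, hs'_apply, hk]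
    have h1 := hs' (x.2 + k₂ x.1)
    have h2 : diagQF F c (k₂ x.1) + diagQF F c (k₂ x.1) = 0 := CharTwo.add_self_eq_zero _
    simp only [X, QuadraticMap.prod_apply, diagQF_add, QuadraticMap.map_zero] at h1 ⊢
    linear_combination -h1 - h2

theorem equivalent_of_wittEquiv [FiniteDimensional F M] [FiniteDimensional F N]
    {q₁ : QuadraticForm F M} {q₂ : QuadraticForm F N} (h : WittEquiv F q₁ q₂)
    (hrad : radDim q₁ = radDim q₂) (m : ℕ)
    (hdim : Module.finrank F M = 2 * m + Module.finrank F N) :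
    q₁.Equivalent ((hypSum F m).prod q₂) := by
  obtain ⟨r, ρ, hρ, ⟨i, j, e₁⟩, ⟨i', j', e₂⟩⟩ := h
  replace e₁ : q₁.Equivalent _ := Equivalent.trans e₁ (wittEquiv_form_equivalent ρ)
  replace e₂ : q₂.Equivalent _ := Equivalent.trans e₂ (wittEquiv_form_equivalent ρ)
  have r₁ := radDim_eq_of_equivalent e₁
  have r₂ := radDim_eq_of_equivalent e₂
  have f₁ := e₁.finrank_eq
  have f₂ := e₂.finrank_eq
  rw [radDim_prod, radDim_prod, radDim_zero, (nonsingular_binSum 0 0).radDim_eq_zero] at r₁ r₂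
  simp only [Module.finrank_prod, Module.finrank_pi_fintype, Module.finrank_self,
    Finset.sum_const, Finset.card_univ, Fintype.card_fin, smul_eq_mul, mul_one] at f₁ f₂
  obtain rfl : j = j' := by omega
  obtain rfl : i = m + i' := by omega
  exact e₁.trans ((hypSum_prod_prod_prod_equivalent m i' ρ _).symm.trans
    ((Equivalent.refl _).prod e₂.symm))

theorem prod_diagQF_equivalent_of_hypSum_prod [FiniteDimensional F N] [FiniteDimensional F M]
    {m n : ℕ} {φ : QF F m}
    (hφ : Nonsingular F φ) {ψ : QuadraticForm F M} {τ : QuadraticForm F N} {c : Fin n → F}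
    (h : ((ψ.prod φ).prod (diagQF F c)).Equivalent
      ((hypSum F (m + n)).prod (τ.prod (diagQF F c)))) :
    (((hypSum F n).prod (φ.prod τ)).prod (diagQF F c)).Equivalent (ψ.prod (diagQF F c)) := by
  refine equivalent_of_hypSum_prod m ?_
  have h₁ : (φ.prod ((ψ.prod φ).prod (diagQF F c))).Equivalent
      ((hypSum F m).prod (ψ.prod (diagQF F c))) := by
    refine Equivalent.trans ?_ (hφ.prod_self_equivalent.prod (.refl _))
    refine ⟨{ toFun := fun x => ((x.1, x.2.1.2), (x.2.1.1, x.2.2))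
              invFun := fun y => (y.1.1, ((y.2.1, y.1.2), y.2.2))
              left_inv := fun x => rfl
              right_inv := fun y => rfl
              map_add' := fun x y => rfl
              map_smul' := fun a x => rfl
              map_app' := fun x => ?_ }⟩
    simp only [QuadraticMap.prod_apply]
    ring
  refine Equivalent.trans ?_ (((Equivalent.refl φ).prod h.symm).trans h₁)
  have h₂ := (hypSum_add_equivalent (F := F) m n).symm
  refine Equivalent.trans ?_ ((Equivalent.refl φ).prod (h₂.prod (.refl _)))
  refine ⟨{ toFun := fun x => (x.2.1.2.1, ((x.1, x.2.1.1), (x.2.1.2.2, x.2.2)))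
            invFun := fun y => (y.2.1.1, ((y.2.1.2, (y.1, y.2.2.1)), y.2.2.2))
            left_inv := fun x => rfl
            right_inv := fun y => rfl
            map_add' := fun x y => rfl
            map_smul' := fun a x => rfl
            map_app' := fun x => ?_ }⟩
  simp only [QuadraticMap.prod_apply]
  ring

end CharTwo
end Auxiliary

/-- for nonsingular `φ`, `ψ` and totally singular `σ = ⟨c₁,…,c_n⟩` over a field of
characteristic 2, the following are equivalent: (a) `φ ⊥ σ ≺ ψ`; (b) there are a nonsingular `τ`
of dimension `dim ψ − dim φ − 2 dim σ` and `d₁,…,d_n ∈ F` with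
`ψ ≅ φ ⊥ [c₁,d₁] ⊥ … ⊥ [c_n,d_n] ⊥ τ`; (c) there is a nonsingular `τ` of dimension
`dim ψ − dim φ − 2n` with `ψ ⊥ φ ⊥ σ ∼ τ ⊥ σ`. -/
theorem stmt_1 (F : Type) [Field F] [CharP F 2] (nφ nψ n : ℕ)
    (φ : QF F nφ) (ψ : QF F nψ) (c : Fin n → F)
    (hφ : Nonsingular F φ) (hψ : Nonsingular F ψ) :
    (Dominates F (oSum F φ (diagQF F c)) ψ ↔
      (∃ k, k + (nφ + 2 * n) = nψ ∧ ∃ (τ : QF F k) (d : Fin n → F), Nonsingular F τ ∧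
        QIsometric F ψ (oSum F (oSum F φ (oSumFam F fun i => binQF F (c i) (d i))) τ))) ∧
    (Dominates F (oSum F φ (diagQF F c)) ψ ↔
      (∃ k, k + (nφ + 2 * n) = nψ ∧ ∃ τ : QF F k, Nonsingular F τ ∧
        WittEquiv F (oSum F (oSum F ψ φ) (diagQF F c)) (oSum F τ (diagQF F c)))) := by
  have ab : Dominates F (oSum F φ (diagQF F c)) ψ →
      ∃ k, k + (nφ + 2 * n) = nψ ∧ ∃ (τ : QF F k) (d : Fin n → F), Nonsingular F τ ∧
        QIsometric F ψ (oSum F (oSum F φ (oSumFam F fun i => binQF F (c i) (d i))) τ) := by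
    intro h
    obtain ⟨t, ht, hq⟩ := h.congr_left (oSum_equivalent_prod φ (diagQF F c))
    obtain ⟨d, g, hg⟩ := exists_isometry_prod_binSum hψ c t ht fun v => (hq v).symm
    obtain ⟨k, τ, hk, e⟩ := (nonsingular_prod_iff.2
      ⟨hφ, nonsingular_binSum c d⟩).exists_equivalent_prod g hg
    refine ⟨k, ?_, τ, d, (nonsingular_prod_iff.1 (hψ.of_equivalent e)).2, ?_⟩
    · simpa [Module.finrank_prod, Module.finrank_pi_fintype, mul_comm] using hk
    · exact e.trans ((((oSum_equivalent_prod _ _).trans ((Equivalent.refl φ).prod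
        (oSumFam_binQF_equivalent c d))).prod (.refl τ)).symm.trans (oSum_equivalent_prod _ _).symm)
  have iso : ∀ {k : ℕ} {τ : QF F k} {d : Fin n → F},
      QIsometric F ψ (oSum F (oSum F φ (oSumFam F fun i => binQF F (c i) (d i))) τ) →
      ψ.Equivalent ((φ.prod (binSum c d)).prod τ) := fun {k τ d} e =>
    Equivalent.trans e ((oSum_equivalent_prod _ _).trans (((oSum_equivalent_prod _ _).trans
      ((Equivalent.refl φ).prod (oSumFam_binQF_equivalent c d))).prod (.refl τ)))
  have e₁ : (oSum F (oSum F ψ φ) (diagQF F c)).Equivalent ((ψ.prod φ).prod (diagQF F c)) :=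
    (oSum_equivalent_prod _ _).trans ((oSum_equivalent_prod ψ φ).prod (.refl _))
  refine ⟨⟨ab, ?_⟩, ⟨fun h => ?_, ?_⟩⟩
  · rintro ⟨k, -, τ, d, -, e⟩
    exact (dominates_prod_diagQF (iso e)).congr_left (oSum_equivalent_prod _ _).symm
  · obtain ⟨k, hk, τ, d, hτ, e⟩ := ab h
    exact ⟨k, hk, τ, hτ, wittEquiv_of_equivalent_hypSum_prod (nφ + n) (e₁.trans
      ((prod_prod_diagQF_equivalent hφ (iso e)).trans
        ((Equivalent.refl _).prod (oSum_equivalent_prod _ _).symm)))⟩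
  · rintro ⟨k, hk, τ, hτ, h⟩
    have e₂ := oSum_equivalent_prod τ (diagQF F c)
    have e := equivalent_of_wittEquiv h (by
      rw [radDim_eq_of_equivalent e₁, radDim_eq_of_equivalent e₂, radDim_prod, radDim_prod,
        radDim_prod, hψ.radDim_eq_zero, hφ.radDim_eq_zero, hτ.radDim_eq_zero]) (nφ + n) (by
      simp only [Module.finrank_fin_fun]
      omega)
    exact (dominates_of_hypSum_prod_equivalent hφ hτ c
      (prod_diagQF_equivalent_of_hypSum_prod hφ (e₁.symm.trans (e.trans
        ((Equivalent.refl _).prod e₂))))).congr_left (oSum_equivalent_prod _ _).symm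
end

section
/- Let F be a field of characteristic 2, let m be a positive integer, let f(X) ∈ F[X] be an irreducible polynomial of even degree 2m, let α be a root of f in an algebraic closure of F and E = F(α). Let φ be an anisotropic quadratic form over F and assume that the total index of φ_E satisfies i_t(φ_E) > (1/2 − 1/(2m))·dim φ. Then there exists a quadratic form φ_0 dominated by φ with 2 ≤ dim φ_0 ≤ m+1 such that φ_0 represents λf(X) over the polynomial ring F[X] for some λ ∈ F*. In particular, (φ_0)_E is isotropic. -/
open QuadraticMap

variable (F : Type) [Field F]

/-- The value of a quadratic map on a finite sum is determined by its values and polar values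
on the summands. -/
lemma quadraticMap_sum_congr {R M M' P ι : Type} [CommRing R] [AddCommGroup M] [AddCommGroup M']
    [AddCommGroup P] [Module R M] [Module R M'] [Module R P] [Fintype ι]
    (Q : QuadraticMap R M P) (Q' : QuadraticMap R M' P) (x : ι → M) (x' : ι → M')
    (h : ∀ i, Q (x i) = Q' (x' i))
    (hp : ∀ i j, i ≠ j → polar Q (x i) (x j) = polar Q' (x' i) (x' j)) :
    Q (∑ i, x i) = Q' (∑ i, x' i) := by
  classical
  rw [QuadraticMap.map_sum, QuadraticMap.map_sum]
  congr 1
  · exact Finset.sum_congr rfl fun i _ => h i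
  · refine Finset.sum_congr rfl fun ij hij => ?_
    rw [Finset.mem_filter] at hij
    induction ij using Sym2.ind with
    | _ i j => exact hp i j fun hh => hij.2 (Sym2.mk_isDiag_iff.2 hh)

lemma extQF_apply {F : Type} [Field F] (A : Type) [CommRing A] [Algebra F A] {n : ℕ}
    (q : QF F n) (v : Fin n → A) :
    extQF F A q v = ∑ i, ∑ j, algebraMap F A (qMat F q i j) * (v i * v j) := by
  simp only [extQF, Matrix.toQuadraticMap', Matrix.toQuadraticForm',
    LinearMap.BilinMap.toQuadraticMap_apply, Matrix.toLinearMap₂'_apply, Matrix.map_apply,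
    smul_eq_mul]
  exact Finset.sum_congr rfl fun i _ => Finset.sum_congr rfl fun j _ => by ring

lemma map_extQF {F : Type} [Field F] {A B : Type} [CommRing A] [Algebra F A] [CommRing B]
    [Algebra F B] (g : A →ₐ[F] B) {n : ℕ} (q : QF F n) (v : Fin n → A) :
    g (extQF F A q v) = extQF F B q (fun i => g (v i)) := by
  simp [extQF_apply]

lemma extQF_self {F : Type} [Field F] {n : ℕ} (q : QF F n) (x : Fin n → F) :
    extQF F F q x = q x := by
  have hx : x = ∑ i, x i • (Pi.single i 1 : Fin n → F) := pi_eq_sum_univ' x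
  rw [hx]
  refine quadraticMap_sum_congr _ _ _ _ (fun i => ?_) fun i j hij => ?_
  · rw [QuadraticMap.map_smul, QuadraticMap.map_smul, extQF_apply,
      Finset.sum_eq_single i, Finset.sum_eq_single i] <;> simp +contextual [qMat, Pi.single_apply]
  · rw [polar_smul_left, polar_smul_right, polar_smul_left, polar_smul_right]
    congr 2
    simp only [extQF, Matrix.toQuadraticMap', Matrix.toQuadraticForm',
      LinearMap.BilinMap.polar_toQuadraticMap, Matrix.toLinearMap₂'_apply, Matrix.map_apply,
      Algebra.algebraMap_self, RingHom.id_apply, smul_eq_mul]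
    rw [Finset.sum_eq_single i (by simp +contextual [Pi.single_apply]) (by simp),
      Finset.sum_eq_single j (by simp +contextual) (by simp),
      Finset.sum_eq_single j (by simp +contextual [Pi.single_apply]) (by simp),
      Finset.sum_eq_single i (by simp +contextual) (by simp)]
    rcases lt_or_gt_of_ne hij with h | h
    · simp [qMat, hij, hij.symm, h, h.not_gt]
    · simp [qMat, hij, hij.symm, h, h.not_gt, polar_comm q (Pi.single j 1)]

lemma extQF_algebraMap {F : Type} [Field F] (A : Type) [CommRing A] [Algebra F A] {n : ℕ}
    (q : QF F n) (x : Fin n → F) :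
    extQF F A q (fun i => algebraMap F A (x i)) = algebraMap F A (q x) := by
  rw [← extQF_self q x]
  exact (map_extQF (Algebra.ofId F A) q x).symm

lemma polar_extQF_algebraMap {F : Type} [Field F] (A : Type) [CommRing A] [Algebra F A] {n : ℕ}
    (q : QF F n) (x y : Fin n → F) :
    polar (extQF F A q) (fun i => algebraMap F A (x i)) (fun i => algebraMap F A (y i)) =
      algebraMap F A (polar q x y) := by
  have h : ((fun i => algebraMap F A (x i)) + fun i => algebraMap F A (y i)) =
      fun i => algebraMap F A ((x + y) i) := by
    ext i; simp
  simp only [polar, h, extQF_algebraMap, map_sub]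

/-- Scalar extension commutes with pulling back along a linear map. -/
lemma extQF_comp {F : Type} [Field F] (A : Type) [CommRing A] [Algebra F A] {k n : ℕ}
    (q : QF F n) (t : (Fin k → F) →ₗ[F] (Fin n → F)) (y : Fin k → A) :
    extQF F A (q.comp t) y =
      extQF F A q (∑ l, y l • fun i => algebraMap F A (t (Pi.single l 1) i)) := by
  have hy : y = ∑ l, y l • fun i => algebraMap F A ((Pi.single l 1 : Fin k → F) i) := by
    ext i
    simp [Finset.sum_apply, Pi.single_apply, apply_ite (algebraMap F A)]
  conv_lhs => rw [hy]
  refine quadraticMap_sum_congr _ _ _ _ (fun i => ?_) fun i j _ => ?_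
  · rw [QuadraticMap.map_smul, QuadraticMap.map_smul, extQF_algebraMap, extQF_algebraMap]
    rfl
  · rw [polar_smul_left, polar_smul_right, polar_smul_left, polar_smul_right,
      polar_extQF_algebraMap, polar_extQF_algebraMap]
    congr 3
    simp [polar]

lemma natDegree_extQF_le {F : Type} [Field F] {n d : ℕ} (q : QF F n)
    (v : Fin n → Polynomial F) (hv : ∀ i, (v i).natDegree ≤ d) :
    (extQF F (Polynomial F) q v).natDegree ≤ 2 * d := by
  rw [extQF_apply]
  refine Polynomial.natDegree_sum_le_of_forall_le _ _ fun i _ =>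
    Polynomial.natDegree_sum_le_of_forall_le _ _ fun j _ => ?_
  refine (Polynomial.natDegree_C_mul_le _ _).trans (Polynomial.natDegree_mul_le.trans ?_)
  have := hv i
  have := hv j
  omega

lemma coeff_extQF {F : Type} [Field F] {n d : ℕ} (q : QF F n)
    (v : Fin n → Polynomial F) (hv : ∀ i, (v i).natDegree ≤ d) :
    (extQF F (Polynomial F) q v).coeff (d + d) = q fun i => (v i).coeff d := by
  rw [← extQF_self q, extQF_apply, extQF_apply]
  simp only [Polynomial.finsetSum_coeff, Polynomial.algebraMap_eq, Polynomial.coeff_C_mul,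
    Polynomial.coeff_mul_add_eq_of_natDegree_le (hv _) (hv _)]
  rfl

/-- Anisotropy is preserved under extension to the polynomial ring. -/
lemma extQF_polynomial_ne_zero {F : Type} [Field F] {n : ℕ} (q : QF F n)
    (hq : q.Anisotropic) (v : Fin n → Polynomial F) (hv : v ≠ 0) :
    extQF F (Polynomial F) q v ≠ 0 := by
  obtain ⟨i₀, hi₀⟩ := Function.ne_iff.1 hv
  obtain ⟨i, -, hi⟩ := Finset.exists_max_image Finset.univ (fun i => (v i).degree)
    ⟨i₀, Finset.mem_univ _⟩
  have hvi : v i ≠ 0 := by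
    rw [← Polynomial.degree_ne_bot]
    intro h
    have := hi i₀ (Finset.mem_univ _)
    rw [h, le_bot_iff, Polynomial.degree_eq_bot] at this
    exact hi₀ this
  intro h
  have hc := coeff_extQF q v (d := (v i).natDegree) fun j =>
    Polynomial.natDegree_le_natDegree (hi j (Finset.mem_univ _))
  rw [h, Polynomial.coeff_zero] at hc
  have := congrFun (hq _ hc.symm) i
  exact hvi (Polynomial.leadingCoeff_eq_zero.1 this)

/-- An anisotropic form of dimension at most one stays anisotropic over every field extension. -/
lemma anisotropic_extQF_of_lt_two {F : Type} [Field F] (E : Type) [Field E] [Algebra F E]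
    {k : ℕ} (hk : k < 2) (q : QF F k) (hq : q.Anisotropic) : (extQF F E q).Anisotropic := by
  intro y hy
  interval_cases k
  · exact Subsingleton.elim _ _
  · have hy' : y = y 0 • fun i => algebraMap F E ((1 : Fin 1 → F) i) := by
      ext i; simp [Subsingleton.elim i 0]
    rw [hy', QuadraticMap.map_smul, extQF_algebraMap, smul_eq_mul, mul_eq_zero] at hy
    rcases hy with h | h
    · ext i
      simpa [Subsingleton.elim i 0] using h
    · rw [map_eq_zero] at h
      exact absurd (hq _ h) one_ne_zero

/-- A subspace of `Eⁿ` of large dimension contains the value at `α` of a nonzero vector of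
polynomials of degree at most `m`. -/
lemma exists_powers_mem {F E : Type} [Field F] [Field E] [Algebra F E] (α : E) {m d n : ℕ}
    [FiniteDimensional F E] (hd : Module.finrank F E = d) (W : Submodule E (Fin n → E))
    (h : d * n < d * Module.finrank E W + (m + 1) * n) :
    ∃ c : Fin (m + 1) → Fin n → F, c ≠ 0 ∧
      (fun i => ∑ j, algebraMap F E (c j i) * α ^ (j : ℕ)) ∈ W := by
  let T : (Fin (m + 1) → Fin n → F) →ₗ[F] (Fin n → E) :=
    { toFun := fun c i => ∑ j, algebraMap F E (c j i) * α ^ (j : ℕ)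
      map_add' := fun c c' => by
        ext i; simp [add_mul, Finset.sum_add_distrib]
      map_smul' := fun a c => by
        ext i; simp [Finset.mul_sum, mul_assoc, Algebra.smul_def] }
  have hQ : Module.finrank F ((Fin n → E) ⧸ W) + d * Module.finrank E W = d * n := by
    rw [← Module.finrank_mul_finrank F E ((Fin n → E) ⧸ W), hd, ← mul_add,
      Submodule.finrank_quotient_add_finrank, Module.finrank_fin_fun]
  have hlt : Module.finrank F ((Fin n → E) ⧸ W) <
      Module.finrank F (Fin (m + 1) → Fin n → F) := by
    rw [Module.finrank_pi_fintype]
    simp only [Module.finrank_fin_fun, Finset.sum_const, Finset.card_univ, Fintype.card_fin,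
      smul_eq_mul]
    omega
  have : FiniteDimensional F ((Fin n → E) ⧸ W) := FiniteDimensional.trans F E _
  have hker := LinearMap.ker_ne_bot_of_finrank_lt
    (f := (W.mkQ.restrictScalars F).comp T) hlt
  obtain ⟨c, hc, hc0⟩ := (Submodule.ne_bot_iff _).1 hker
  exact ⟨c, hc0, (Submodule.Quotient.mk_eq_zero W).1 hc⟩

/-- A finite family of vectors comes, via an injective linear map, from a coordinate space of
dimension at most its cardinality. -/
lemma exists_injective_lift {F : Type} [Field F] {r n : ℕ} (c : Fin r → Fin n → F) :
    ∃ k ≤ r, ∃ t : (Fin k → F) →ₗ[F] (Fin n → F), Function.Injective t ∧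
      ∃ d : Fin r → Fin k → F, ∀ j, t (d j) = c j := by
  let U := Submodule.span F (Set.range c)
  let e := (Module.finBasis F U).equivFun
  refine ⟨Module.finrank F U, (finrank_range_le_card c).trans_eq (Fintype.card_fin r),
    U.subtype.comp e.symm.toLinearMap, ?_,
    fun j => e ⟨c j, Submodule.subset_span ⟨j, rfl⟩⟩, fun j => by simp⟩
  exact U.injective_subtype.comp e.symm.injective

/-- Sivatski's proposition in characteristic 2: if `f` is irreducible of even
degree `2m`, `E = F(α)` for a root `α` of `f`, `φ` is anisotropic over `F` and the total index of
`φ_E` (the dimension of a maximal totally isotropic subspace) exceeds `(1/2 − 1/(2m))·dim φ`,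
then some `φ₀ ≺ φ` with `2 ≤ dim φ₀ ≤ m+1` represents `λ f(X)` over `F[X]` for some `λ ∈ F*`;
in particular `(φ₀)_E` is isotropic. -/
theorem stmt_3 (F : Type) [Field F] [CharP F 2] (E : Type) [Field E] [Algebra F E]
    (m : ℕ) (hm : 0 < m) (f : Polynomial F) (hirr : Irreducible f) (hdeg : f.natDegree = 2 * m)
    (α : E) (hroot : Polynomial.aeval α f = 0)
    (hE : IntermediateField.adjoin F {α} = ⊤)
    (N : ℕ) (φ : QF F N) (han : φ.Anisotropic)
    (hind : ∃ W : Submodule E (Fin N → E), (∀ x ∈ W, extQF F E φ x = 0) ∧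
      (m - 1) * N < 2 * m * Module.finrank E W) :
    ∃ k : ℕ, 2 ≤ k ∧ k ≤ m + 1 ∧ ∃ φ₀ : QF F k, Dominates F φ₀ φ ∧
      (∃ lam : F, lam ≠ 0 ∧ ∃ v : Fin k → Polynomial F,
        extQF F (Polynomial F) φ₀ v = Polynomial.C lam * f) ∧
      ¬ (extQF F E φ₀).Anisotropic := by
  obtain ⟨W, hW, hdim⟩ := hind
  have hα : IsIntegral F α := (IsAlgebraic.isIntegral ⟨f, hirr.ne_zero, hroot⟩)
  have hlead : f.leadingCoeff⁻¹ ≠ 0 :=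
    inv_ne_zero (Polynomial.leadingCoeff_ne_zero.2 hirr.ne_zero)
  have hmin := minpoly.eq_of_irreducible hirr hroot
  have hdvd : ∀ g : Polynomial F, Polynomial.aeval α g = 0 → f ∣ g := fun g hg =>
    (Dvd.intro _ hmin).trans (minpoly.dvd F α hg)
  have hfin : Module.finrank F E = 2 * m := by
    rw [← IntermediateField.finrank_top', ← hE, IntermediateField.adjoin.finrank hα, ← hmin,
      Polynomial.natDegree_mul_C hlead, hdeg]
  have : FiniteDimensional F E := Module.finite_of_finrank_pos (by omega)
  obtain ⟨c, hc0, hcW⟩ := exists_powers_mem α (m := m) hfin W (by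
    obtain ⟨m, rfl⟩ : ∃ m', m = m' + 1 := ⟨m - 1, by omega⟩
    simp only [Nat.add_sub_cancel] at hdim
    linarith)
  obtain ⟨k, hk, t, ht, d, hd⟩ := exists_injective_lift c
  have han₀ : (φ.comp t).Anisotropic := fun x hx =>
    ht ((han _ hx).trans (map_zero t).symm)
  let u : Fin k → Polynomial F := fun l => ∑ j : Fin (m + 1), Polynomial.monomial j (d j l)
  have hcoeff : ∀ (l : Fin k) (j : Fin (m + 1)), (u l).coeff j = d j l := fun l j => by
    simp [u, Polynomial.coeff_monomial, Fin.val_inj]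
  have hu0 : u ≠ 0 := fun h => hc0 <| funext fun j => by
    have : d j = 0 := funext fun l => by simp [← hcoeff l j, h]
    rw [← hd, this, map_zero, Pi.zero_apply]
  have hudeg : ∀ l, (u l).natDegree ≤ m := fun l =>
    Polynomial.natDegree_sum_le_of_forall_le _ _ fun j _ =>
      (Polynomial.natDegree_monomial_le _).trans (Nat.lt_succ_iff.1 j.2)
  have hval : ∑ l, Polynomial.aeval α (u l) • (fun i => algebraMap F E (t (Pi.single l 1) i)) =
      fun i => ∑ j, algebraMap F E (c j i) * α ^ (j : ℕ) := by
    ext i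
    have hdj : ∀ j, c j i = ∑ l, d j l * t (Pi.single l 1) i := fun j => by
      conv_lhs => rw [← hd j, pi_eq_sum_univ' (d j)]
      simp [Finset.sum_apply]
    simp only [u, Finset.sum_apply, Pi.smul_apply, smul_eq_mul, map_sum,
      Polynomial.aeval_monomial, hdj, map_mul, Finset.sum_mul]
    rw [Finset.sum_comm]
    exact Finset.sum_congr rfl fun j _ => Finset.sum_congr rfl fun l _ => by ring
  have hiso : extQF F E (φ.comp t) (fun l => Polynomial.aeval α (u l)) = 0 := by
    rw [extQF_comp, hval]
    exact hW _ hcW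
  have hisoE : ¬ (extQF F E (φ.comp t)).Anisotropic := fun h => hu0 <| funext fun l => by
    by_contra hl
    have := Polynomial.natDegree_le_of_dvd (hdvd (u l) (congrFun (h _ hiso) l)) hl
    have := hudeg l
    omega
  have hP0 := extQF_polynomial_ne_zero _ han₀ u hu0
  obtain ⟨g, hg⟩ := hdvd (extQF F (Polynomial F) (φ.comp t) u)
    ((map_extQF (Polynomial.aeval α) _ u).trans hiso)
  have hg0 : g ≠ 0 := fun h => hP0 (by rw [hg, h, mul_zero])
  have hgdeg : g.natDegree = 0 := by
    have := natDegree_extQF_le (φ.comp t) u hudeg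
    rw [hg, Polynomial.natDegree_mul hirr.ne_zero hg0] at this
    omega
  rw [Polynomial.eq_C_of_natDegree_eq_zero hgdeg] at hg hg0
  refine ⟨k, ?_, hk, φ.comp t, ⟨t, ht, fun _ => rfl⟩,
    ⟨g.coeff 0, fun h => hg0 (by rw [h, map_zero]), u, by rw [hg, mul_comm]⟩, hisoE⟩
  by_contra hk2
  exact hisoE (anisotropic_extQF_of_lt_two E (by omega) _ han₀)
end
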